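/- Let T be a Sylow 3-subgroup of G_x and let T₀ ≤ T be a subgroup such that C_{Z_x}(T) is properly contained in C_{Z_x}(T₀). Then [T₀, Z_x] = 1, i.e. T₀ centralizes Z_x. -/

import Mathlib

open MulAction Pointwise

/-- `V`, the `n`-dimensional vector space over the field with 3 elements. -/
abbrev Vec (n : ℕ) := Fin n → ZMod 3

/-- The translation subgroup `V` of `Perm (Vec n)`. -/
def TransGrp (n : ℕ) : Subgroup (Equiv.Perm (Vec n)) :=
  Subgroup.closure {f : Equiv.Perm (Vec n) | ∃ w, ∀ v, f v = v + w}

/-- The Frobenius group `L = V ⋊ C₂` of order `2·3^n`, acting on `V = Vec n`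
by `v ↦ ε·v + w` with `ε = ±1`: it is generated by the translations and negation. -/
def Lgrp (n : ℕ) : Subgroup (Equiv.Perm (Vec n)) :=
  Subgroup.closure ({f : Equiv.Perm (Vec n) | ∃ w, ∀ v, f v = v + w} ∪ {Equiv.neg (Vec n)})

/-- The pointwise stabilizer `G_u^{[s]}` in `G` of the ball of radius `s` around `u`. -/
def ballStab {α : Type*} (Γ : SimpleGraph α) (G : Type*) [Group G] [MulAction G α]
    (u : α) (s : ℕ) : Subgroup G :=
  ⨅ w ∈ {w : α | Γ.dist u w ≤ s}, stabilizer G w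

/-- `Z_{uw} = Ω₁(Z(G_u ∩ G_w))`, the subgroup generated by the elements of order at most 2
of the centre of the arc stabilizer `G_u ∩ G_w`. -/
def Zuw {α : Type*} (G : Type*) [Group G] [MulAction G α] (u w : α) : Subgroup G :=
  Subgroup.closure {g : G |
    g ∈ (stabilizer G u ⊓ stabilizer G w) ⊓
        Subgroup.centralizer ((stabilizer G u ⊓ stabilizer G w : Subgroup G) : Set G) ∧ g ^ 2 = 1}

/-- `Z_u = ⟨Z_{uw}^{G_u}⟩`, the normal closure in `G_u` of the subgroups `Z_{uw}`,
for `w` a neighbour of `u` (independent of the choice of `w` by arc-transitivity). -/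
def Zsub {α : Type*} (Γ : SimpleGraph α) (G : Type*) [Group G] [MulAction G α]
    (u : α) : Subgroup G :=
  Subgroup.closure {k : G | ∃ h ∈ stabilizer G u, ∃ w ∈ Γ.neighborSet u,
    ∃ g ∈ Zuw G u w, k = h * g * h⁻¹}

/-- The critical distance `b = min { d(u,v) : Z_u ≰ G_v^{[1]} }`. -/
noncomputable def critDist {α : Type*} (Γ : SimpleGraph α) (G : Type*) [Group G]
    [MulAction G α] : ℕ :=
  sInf {d : ℕ | ∃ u v : α, Γ.dist u v = d ∧ ¬ Zsub Γ G u ≤ ballStab Γ G v 1}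

/-- `(u,v)` is a critical pair: `d(u,v) = b` and `Z_u ≰ G_v^{[1]}`. -/
def critPair {α : Type*} (Γ : SimpleGraph α) (G : Type*) [Group G] [MulAction G α]
    (u v : α) : Prop :=
  Γ.dist u v = critDist Γ G ∧ ¬ Zsub Γ G u ≤ ballStab Γ G v 1

/-- `(Γ, G)` is locally `L`: for each vertex `u` there is a bijection
`φ : Γ(u) ≃ V` conjugating the permutation group induced by `G_u` on `Γ(u)`
to exactly the permutation group `L` acting on `V`. -/
def LocallyL {α : Type*} (n : ℕ) (Γ : SimpleGraph α) (G : Type*) [Group G]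
    [MulAction G α] : Prop :=
  ∀ u : α, ∃ φ : Γ.neighborSet u ≃ Vec n,
    (∀ g ∈ stabilizer G u, ∃ l ∈ Lgrp n, ∀ z : Γ.neighborSet u,
      ∃ hz : (g • (z : α)) ∈ Γ.neighborSet u, φ ⟨g • (z : α), hz⟩ = l (φ z)) ∧
    (∀ l ∈ Lgrp n, ∃ g ∈ stabilizer G u, ∀ z : Γ.neighborSet u,
      ∃ hz : (g • (z : α)) ∈ Γ.neighborSet u, φ ⟨g • (z : α), hz⟩ = l (φ z))

section FixedPoints

/-- Let `Z` be a group of exponent 2 with commuting automorphisms `A`, `A'` of order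
dividing 3 inverted by `B`, where `B` moves each element by at most the fixed element `c`.
If `A` is nontrivial on `Z`, then every fixed point of `A` is a fixed point of `A'`. -/
theorem fixed_of_fixed_of_transvection {G : Type*} [Group G] (Z : Subgroup G)
    (hexp : ∀ m ∈ Z, m * m = 1) (A A' B : G →* G) (hA : ∀ m ∈ Z, A m ∈ Z) (hA' : ∀ m ∈ Z, A' m ∈ Z)
    (hA3 : ∀ m ∈ Z, A (A (A m)) = m) (hA'3 : ∀ m ∈ Z, A' (A' (A' m)) = m)
    (hAA' : ∀ m ∈ Z, A (A' m) = A' (A m))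
    (hBA : ∀ m ∈ Z, B (A m) = A (A (B m))) (hBA' : ∀ m ∈ Z, B (A' m) = A' (A' (B m)))
    (c : G) (hc : c ∈ Z) (hB : ∀ m ∈ Z, B m = m ∨ B m = m * c)
    (hne : ∃ m ∈ Z, A m ≠ m) : ∀ m ∈ Z, A m = m → A' m = m := by
  have hfix : ∀ m ∈ Z, A m = m → B m = m := by
    intro m hm ham
    rcases hB m hm with h | h
    · exact h
    exfalso
    have hcc : A (A c) = c := by
      have h1 := hBA m hm
      rw [ham, h, map_mul, map_mul, ham, ham] at h1
      exact (mul_left_cancel h1).symm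
    have hac : A c = c := by
      have h1 := hA3 c hc
      rwa [hcc] at h1
    have key : ∀ z ∈ Z, ∃ d ∈ Z, A d = d ∧ A (A z) = A z * d := by
      intro z hz
      have h1 := hBA z hz
      rcases hB z hz with h2 | h2 <;> rcases hB (A z) (hA z hz) with h3 | h3 <;>
        rw [h2, h3] at h1
      · exact ⟨1, Z.one_mem, map_one A, by rw [← h1, mul_one]⟩
      · exact ⟨c, hc, hac, h1.symm⟩
      · refine ⟨c, hc, hac, ?_⟩
        rw [map_mul, map_mul, hac, hac] at h1
        calc A (A z) = A (A z) * c * c := by rw [mul_assoc, hexp c hc, mul_one]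
          _ = A z * c := by rw [← h1]
      · refine ⟨1, Z.one_mem, map_one A, ?_⟩
        rw [map_mul, map_mul, hac, hac] at h1
        exact (mul_right_cancel h1).symm.trans (mul_one _).symm
    obtain ⟨w, hw, hwn⟩ := hne
    obtain ⟨d, hd, had, hdw⟩ := key (A (A w)) (hA _ (hA _ hw))
    rw [hA3 w hw] at hdw
    have h3 := hA3 w hw
    rw [hdw, map_mul, hdw, had, map_mul, map_mul, hdw, had] at h3
    have : d = 1 := by
      have h4 : w * d * d * d = w * d := by
        rw [mul_assoc (w * d), hexp d hd, mul_one]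
      rw [h4] at h3
      simpa using h3
    exact hwn (by rw [hdw, this, mul_one])
  intro m hm ham
  have h1 : B (A' m) = A' m := hfix _ (hA' m hm) (by rw [hAA' m hm, ham])
  rw [hBA' m hm, hfix m hm ham] at h1
  have h2 := hA'3 m hm
  rwa [h1, h1] at h2

end FixedPoints

section LocalAction

variable {α : Type*} {n : ℕ} {Γ : SimpleGraph α} {G : Type*} [Group G] [MulAction G α]

theorem eq_one_or_eq_neg_one_of_mul_self {e : ZMod 3} (he : e * e = 1) : e = 1 ∨ e = -1 := by
  revert e
  decide

theorem exists_affine_of_mem_Lgrp {l : Equiv.Perm (Vec n)} (hl : l ∈ Lgrp n) :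
    ∃ (e : ZMod 3) (w : Vec n), e * e = 1 ∧ ∀ v, l v = e • v + w := by
  induction hl using Subgroup.closure_induction with
  | mem f hf =>
    rcases hf with ⟨w, hw⟩ | hf
    · exact ⟨1, w, by decide, fun v => by rw [hw, one_smul]⟩
    · rw [Set.mem_singleton_iff] at hf
      exact ⟨-1, 0, by decide, fun v => by simp [hf]⟩
  | one => exact ⟨1, 0, by decide, fun v => by simp⟩
  | mul f g _ _ hf hg =>
    obtain ⟨e, w, he, hw⟩ := hf
    obtain ⟨e', w', he', hw'⟩ := hg
    refine ⟨e * e', e • w' + w, ?_, fun v => ?_⟩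
    · rw [mul_mul_mul_comm, he, he', one_mul]
    · rw [Equiv.Perm.mul_apply, hw', hw, smul_add, smul_smul, add_assoc]
  | inv f _ hf =>
    obtain ⟨e, w, he, hw⟩ := hf
    refine ⟨e, -(e • w), he, fun v => ?_⟩
    rw [Equiv.Perm.inv_eq_iff_eq, hw, smul_add, smul_smul, smul_neg, smul_smul, he]
    simp

/-- `g` acts on the neighbourhood of `u` as `v ↦ e • v + w` in the coordinates `φ`. -/
def ActsAffinely {u : α} (φ : Γ.neighborSet u ≃ Vec n) (g : G) (e : ZMod 3) (w : Vec n) : Prop :=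
  ∀ z : Γ.neighborSet u, ∃ hz : (g • (z : α)) ∈ Γ.neighborSet u, φ ⟨g • (z : α), hz⟩ = e • φ z + w

namespace ActsAffinely

variable {u : α} {φ : Γ.neighborSet u ≃ Vec n} {g g' : G} {e e' : ZMod 3} {w w' : Vec n}

theorem mul (h : ActsAffinely φ g e w) (h' : ActsAffinely φ g' e' w') :
    ActsAffinely φ (g * g') (e * e') (e • w' + w) := by
  intro z
  obtain ⟨hz, h1⟩ := h' z
  obtain ⟨hz', h2⟩ := h ⟨g' • (z : α), hz⟩
  rw [h1] at h2
  simp only [mul_smul]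
  exact ⟨hz', by rw [h2, smul_add, smul_smul, add_assoc]⟩

theorem one : ActsAffinely φ (1 : G) 1 0 := by
  intro z
  simp only [one_smul]
  exact ⟨z.2, by simp⟩

theorem inv (he : e * e = 1) (h : ActsAffinely φ g e w) :
    ActsAffinely φ g⁻¹ e (-(e • w)) := by
  intro z
  obtain ⟨hz, h1⟩ := h (φ.symm (e • (φ z - w)))
  rw [Equiv.apply_symm_apply, smul_smul, he, one_smul, sub_add_cancel] at h1
  have h2 := congrArg Subtype.val (φ.injective h1)
  have h3 : g⁻¹ • (z : α) = φ.symm (e • (φ z - w)) := by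
    rw [← h2, inv_smul_smul]
  simp only [h3]
  refine ⟨Subtype.coe_prop _, ?_⟩
  simp [sub_eq_add_neg]

theorem pow (h : ActsAffinely φ g e w) (k : ℕ) : ∃ w', ActsAffinely φ (g ^ k) (e ^ k) w' := by
  induction k with
  | zero => exact ⟨0, by simpa using one⟩
  | succ k ih =>
    obtain ⟨w', hw'⟩ := ih
    exact ⟨_, by simpa only [pow_succ] using hw'.mul h⟩

theorem unique (hn : n ≠ 0) (h : ActsAffinely φ g e w) (h' : ActsAffinely φ g e' w') :
    e = e' := by
  have hall : ∀ v : Vec n, e • v + w = e' • v + w' := by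
    intro v
    obtain ⟨_, h1⟩ := h (φ.symm v)
    obtain ⟨_, h2⟩ := h' (φ.symm v)
    rw [Equiv.apply_symm_apply] at h1 h2
    exact h1.symm.trans h2
  have h0 : w = w' := by simpa using hall 0
  have h1 := congrFun (hall 1) ⟨0, Nat.pos_of_ne_zero hn⟩
  simpa [h0] using h1

end ActsAffinely

theorem mem_ballStab_one (hconn : Γ.Connected) {u : α} {g : G} :
    g ∈ ballStab Γ G u 1 ↔ g • u = u ∧ ∀ w, Γ.Adj u w → g • w = w := by
  simp only [ballStab, Subgroup.mem_iInf, Set.mem_ofPred_eq, mem_stabilizer_iff]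
  constructor
  · intro h
    exact ⟨h u (by simp), fun w hw => h w (SimpleGraph.dist_eq_one_iff_adj.2 hw).le⟩
  · rintro ⟨h1, h2⟩ w hw
    rcases Nat.le_one_iff_eq_zero_or_eq_one.1 hw with h | h
    · rw [← (hconn.dist_eq_zero_iff).1 h, h1]
    · exact h2 w (SimpleGraph.dist_eq_one_iff_adj.1 h)

theorem conj_mem_ballStab_one (hconn : Γ.Connected)
    (haut : ∀ (g : G) (u w : α), Γ.Adj u w ↔ Γ.Adj (g • u) (g • w)) {u : α} {k : G}
    (hk : k ∈ ballStab Γ G u 1) (g : G) : g * k * g⁻¹ ∈ ballStab Γ G (g • u) 1 := by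
  rw [mem_ballStab_one hconn] at hk ⊢
  refine ⟨by simp [mul_smul, hk.1], fun w hw => ?_⟩
  have : Γ.Adj u (g⁻¹ • w) := by rw [haut g]; simpa using hw
  rw [mul_smul, mul_smul, hk.2 _ this, smul_inv_smul]

theorem conj_mem_ballStab_one_of_mem_stabilizer (hconn : Γ.Connected)
    (haut : ∀ (g : G) (u w : α), Γ.Adj u w ↔ Γ.Adj (g • u) (g • w)) {u : α} {k g : G}
    (hk : k ∈ ballStab Γ G u 1) (hg : g ∈ stabilizer G u) :
    g * k * g⁻¹ ∈ ballStab Γ G u 1 := by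
  have := conj_mem_ballStab_one hconn haut hk g
  rwa [mem_stabilizer_iff.1 hg] at this

theorem ballStab_one_le_stabilizer (hconn : Γ.Connected) (u : α) :
    ballStab Γ G u 1 ≤ stabilizer G u :=
  fun _ hg => ((mem_ballStab_one hconn).1 hg).1

theorem ActsAffinely.mem_ballStab_one (hconn : Γ.Connected) {u : α}
    {φ : Γ.neighborSet u ≃ Vec n} {g : G} (hg : g ∈ stabilizer G u)
    (h : ActsAffinely φ g 1 0) : g ∈ ballStab Γ G u 1 := by
  rw [_root_.mem_ballStab_one hconn]
  refine ⟨hg, fun w hw => ?_⟩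
  obtain ⟨hz, h1⟩ := h ⟨w, hw⟩
  rw [one_smul, add_zero] at h1
  exact congrArg Subtype.val (φ.injective h1)

theorem ActsAffinely.inv_mul_mem_ballStab_one (hconn : Γ.Connected) {u : α}
    {φ : Γ.neighborSet u ≃ Vec n} {g g' : G} {e : ZMod 3} {w : Vec n}
    (hg : g ∈ stabilizer G u) (hg' : g' ∈ stabilizer G u) (he : e * e = 1)
    (h : ActsAffinely φ g e w) (h' : ActsAffinely φ g' e w) :
    g⁻¹ * g' ∈ ballStab Γ G u 1 := by
  refine ActsAffinely.mem_ballStab_one (φ := φ) hconn (mul_mem (inv_mem hg) hg') ?_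
  simpa [he] using (h.inv he).mul h'

/-- A coordinatization of the neighbourhood of `u` as in `LocallyL`. -/
def IsLocalChart {u : α} (G : Type*) [Group G] [MulAction G α]
    (φ : Γ.neighborSet u ≃ Vec n) : Prop :=
  (∀ g ∈ stabilizer G u, ∃ (e : ZMod 3) (w : Vec n), e * e = 1 ∧ ActsAffinely φ g e w) ∧
    ∀ w : Vec n, ∃ g ∈ stabilizer G u, ActsAffinely φ g 1 w

theorem LocallyL.exists_isLocalChart (hloc : LocallyL n Γ G) (u : α) :
    ∃ φ : Γ.neighborSet u ≃ Vec n, IsLocalChart G φ := by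
  obtain ⟨φ, h1, h2⟩ := hloc u
  refine ⟨φ, fun g hg => ?_, fun w => ?_⟩
  · obtain ⟨l, hl, h⟩ := h1 g hg
    obtain ⟨e, w, he, hw⟩ := exists_affine_of_mem_Lgrp hl
    refine ⟨e, w, he, fun z => ?_⟩
    obtain ⟨hz, h3⟩ := h z
    exact ⟨hz, by rw [h3, hw]⟩
  · obtain ⟨g, hg, h⟩ := h2 (Equiv.addRight w)
      (Subgroup.subset_closure (Or.inl ⟨w, fun v => rfl⟩))
    refine ⟨g, hg, fun z => ?_⟩
    obtain ⟨hz, h3⟩ := h z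
    exact ⟨hz, by rw [h3, one_smul]; rfl⟩

namespace IsLocalChart

variable {u : α} {φ : Γ.neighborSet u ≃ Vec n}

theorem neg_of_notMem (hφ : IsLocalChart G φ) (hconn : Γ.Connected) {w : α} (hw : Γ.Adj u w)
    {g : G} (hg : g ∈ stabilizer G u) (hgw : g ∈ stabilizer G w)
    (hgQ : g ∉ ballStab Γ G u 1) : ActsAffinely φ g (-1) (φ ⟨w, hw⟩ + φ ⟨w, hw⟩) := by
  obtain ⟨e, c, he, h⟩ := hφ.1 g hg
  obtain ⟨hz, h1⟩ := h ⟨w, hw⟩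
  have h2 : φ ⟨w, hw⟩ = e • φ ⟨w, hw⟩ + c := by
    rw [← h1]
    congr 2
    exact (mem_stabilizer_iff.1 hgw).symm
  rcases eq_one_or_eq_neg_one_of_mul_self he with rfl | rfl
  · rw [one_smul] at h2
    have hc : c = 0 := by simpa using h2.symm
    subst hc
    exact absurd (h.mem_ballStab_one hconn hg) hgQ
  · have hc : c = φ ⟨w, hw⟩ + φ ⟨w, hw⟩ := by
      rw [neg_one_smul] at h2
      nth_rewrite 1 [h2]
      abel
    rwa [← hc]

theorem inv_mul_mem (hφ : IsLocalChart G φ) (hconn : Γ.Connected) {w : α} (hw : Γ.Adj u w)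
    {g g' : G} (hg : g ∈ stabilizer G u) (hgw : g ∈ stabilizer G w)
    (hgQ : g ∉ ballStab Γ G u 1) (hg' : g' ∈ stabilizer G u) (hgw' : g' ∈ stabilizer G w)
    (hgQ' : g' ∉ ballStab Γ G u 1) : g⁻¹ * g' ∈ ballStab Γ G u 1 :=
  (hφ.neg_of_notMem hconn hw hg hgw hgQ).inv_mul_mem_ballStab_one hconn hg hg' (by decide)
    (hφ.neg_of_notMem hconn hw hg' hgw' hgQ')

theorem sq_mem (hφ : IsLocalChart G φ) (hconn : Γ.Connected) {w : α} (hw : Γ.Adj u w)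
    {g : G} (hg : g ∈ stabilizer G u) (hgw : g ∈ stabilizer G w) :
    g ^ 2 ∈ ballStab Γ G u 1 := by
  by_cases hQ : g ∈ ballStab Γ G u 1
  · exact pow_mem hQ 2
  · have := hφ.inv_mul_mem hconn hw (inv_mem hg) (inv_mem hgw) (by simpa using hQ) hg hgw hQ
    rwa [inv_inv, ← sq] at this

/-- The normal closure in `G_u` of an element of `G_{uw}` outside the kernel, together with the
kernel, is all of `G_u`. -/
theorem stabilizer_le (hφ : IsLocalChart G φ) (hconn : Γ.Connected) {w : α} (hw : Γ.Adj u w)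
    {g : G} (hg : g ∈ stabilizer G u) (hgw : g ∈ stabilizer G w)
    (hgQ : g ∉ ballStab Γ G u 1) (N : Subgroup G) (hQN : ballStab Γ G u 1 ≤ N)
    (hgN : ∀ k ∈ stabilizer G u, k * g * k⁻¹ ∈ N) : stabilizer G u ≤ N := by
  have hneg := hφ.neg_of_notMem hconn hw hg hgw hgQ
  have htrans : ∀ h ∈ stabilizer G u, ∀ c, ActsAffinely φ h 1 c → h ∈ N := by
    intro h hh c hc
    obtain ⟨k, hk, hkc⟩ := hφ.2 c
    have hcom : g * (k * g * k⁻¹)⁻¹ ∈ N := by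
      refine mul_mem ?_ (inv_mem (hgN k hk))
      simpa using hgN 1 (one_mem _)
    have hst : g * (k * g * k⁻¹)⁻¹ ∈ stabilizer G u :=
      mul_mem hg (inv_mem (mul_mem (mul_mem hk hg) (inv_mem hk)))
    have hact : ActsAffinely φ (g * (k * g * k⁻¹)⁻¹) 1 c := by
      have h1 := hneg.mul (((hkc.mul hneg).mul (hkc.inv (by decide))).inv (by decide))
      convert h1 using 1
      · decide
      · ext i
        simp only [Pi.add_apply, Pi.smul_apply, Pi.neg_apply, smul_eq_mul]
        generalize c i = s
        generalize φ ⟨w, hw⟩ i = r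
        revert s r
        decide
    have := hact.inv_mul_mem_ballStab_one hconn hst hh (by decide) hc
    simpa only [mul_inv_cancel_left] using mul_mem hcom (hQN this)
  intro h hh
  obtain ⟨e, c, he, hc⟩ := hφ.1 h hh
  rcases eq_one_or_eq_neg_one_of_mul_self he with rfl | rfl
  · exact htrans h hh c hc
  · have h1 : g * h ∈ N := htrans _ (mul_mem hg hh) _ (by simpa using hneg.mul hc)
    have h2 : g ∈ N := by simpa using hgN 1 (one_mem _)
    exact (Subgroup.mul_mem_cancel_left N h2).1 h1

theorem translation_of_pow_eq_one (hφ : IsLocalChart G φ) (hn : n ≠ 0) {a : G}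
    (ha : a ∈ stabilizer G u) {k : ℕ} (hk : Odd k) (hak : a ^ k = 1) :
    ∃ w, ActsAffinely φ a 1 w := by
  obtain ⟨e, w, he, h⟩ := hφ.1 a ha
  rcases eq_one_or_eq_neg_one_of_mul_self he with rfl | rfl
  · exact ⟨w, h⟩
  · obtain ⟨w', h'⟩ := h.pow k
    rw [hak, hk.neg_one_pow] at h'
    exact absurd (h'.unique hn ActsAffinely.one) (by decide)

end IsLocalChart

/-- A symmetric property of arcs which passes to arcs with the same origin holds everywhere
once it holds for one arc. -/
theorem forall_arc_of_propagates (hconn : Γ.Connected) (P : α → α → Prop)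
    (hsymm : ∀ u w, Γ.Adj u w → P u w → P w u)
    (hstep : ∀ u w w', Γ.Adj u w → Γ.Adj u w' → P u w → P u w')
    {x y : α} (hxy : Γ.Adj x y) (h : P x y) (u : α) : ∃ w, Γ.Adj u w ∧ P u w := by
  obtain ⟨q⟩ := hconn.preconnected u x
  induction q with
  | nil => exact ⟨y, hxy, h⟩
  | cons hadj _ ih =>
    obtain ⟨w, hw, hP⟩ := ih hxy h
    exact ⟨_, hadj, hsymm _ _ hadj.symm (hstep _ _ _ hw hadj.symm hP)⟩

end LocalAction

section ArcCentre

variable {α : Type*} {n : ℕ} {Γ : SimpleGraph α} {G : Type*} [Group G] [MulAction G α]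

theorem mem_Zuw {u w : α} {g : G} :
    g ∈ Zuw G u w ↔ (g ∈ stabilizer G u ∧ g ∈ stabilizer G w) ∧
      (∀ h ∈ stabilizer G u, h ∈ stabilizer G w → h * g = g * h) ∧ g ^ 2 = 1 := by
  constructor
  · intro hg
    induction hg using Subgroup.closure_induction with
    | mem g hg =>
      obtain ⟨⟨h1, h2⟩, h3⟩ := hg
      exact ⟨h1, fun h hu hw => Subgroup.mem_centralizer_iff.1 h2 h ⟨hu, hw⟩, h3⟩
    | one => exact ⟨⟨one_mem _, one_mem _⟩, by simp, by simp⟩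
    | mul a b _ _ ha hb =>
      refine ⟨⟨mul_mem ha.1.1 hb.1.1, mul_mem ha.1.2 hb.1.2⟩, fun h hu hw => ?_, ?_⟩
      · rw [← mul_assoc, ha.2.1 h hu hw, mul_assoc, hb.2.1 h hu hw, mul_assoc]
      · have hab : Commute a b := hb.2.1 a ha.1.1 ha.1.2
        rw [hab.mul_pow, ha.2.2, hb.2.2, one_mul]
    | inv a _ ha =>
      refine ⟨⟨inv_mem ha.1.1, inv_mem ha.1.2⟩, fun h hu hw => ?_, by rw [inv_pow, ha.2.2, inv_one]⟩
      exact ((show Commute h a from ha.2.1 h hu hw).inv_right : Commute h a⁻¹)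
  · rintro ⟨h1, h2, h3⟩
    exact Subgroup.subset_closure
      ⟨⟨h1, Subgroup.mem_centralizer_iff.2 fun h hh => h2 h hh.1 hh.2⟩, h3⟩

theorem Zuw_symm {u w : α} {g : G} (hg : g ∈ Zuw G u w) : g ∈ Zuw G w u := by
  rw [mem_Zuw] at hg ⊢
  exact ⟨hg.1.symm, fun h hu hw => hg.2.1 h hw hu, hg.2.2⟩

theorem conj_mem_stabilizer {u : α} {k : G} (hk : k ∈ stabilizer G u) (g : G) :
    g * k * g⁻¹ ∈ stabilizer G (g • u) := by
  rw [mem_stabilizer_iff] at hk ⊢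
  simp [mul_smul, hk]

theorem conj_mem_Zuw {u w : α} {z : G} (hz : z ∈ Zuw G u w) (g : G) :
    g * z * g⁻¹ ∈ Zuw G (g • u) (g • w) := by
  rw [mem_Zuw] at hz ⊢
  refine ⟨⟨conj_mem_stabilizer hz.1.1 g, conj_mem_stabilizer hz.1.2 g⟩, fun h hu hw => ?_, ?_⟩
  · have h1 := conj_mem_stabilizer hu g⁻¹
    have h2 := conj_mem_stabilizer hw g⁻¹
    rw [inv_smul_smul] at h1 h2
    have h3 := hz.2.1 _ h1 h2
    calc h * (g * z * g⁻¹) = g * (g⁻¹ * h * g⁻¹⁻¹ * z) * g⁻¹ := by group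
      _ = g * (z * (g⁻¹ * h * g⁻¹⁻¹)) * g⁻¹ := by rw [h3]
      _ = g * z * g⁻¹ * h := by group
  · rw [conj_pow, hz.2.2]; simp

theorem conj_mem_Zsub {u : α} {z g : G} (hz : z ∈ Zsub Γ G u) (hg : g ∈ stabilizer G u) :
    g * z * g⁻¹ ∈ Zsub Γ G u := by
  induction hz using Subgroup.closure_induction with
  | mem k hk =>
    obtain ⟨h, hh, w, hw, z, hz, rfl⟩ := hk
    exact Subgroup.subset_closure ⟨g * h, mul_mem hg hh, w, hw, z, hz, by group⟩
  | one => simp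
  | mul a b _ _ ha hb => simpa using mul_mem ha hb
  | inv a _ ha => simpa [mul_assoc] using inv_mem ha

theorem Zuw_le_Zsub {u w : α} (hw : Γ.Adj u w) : Zuw G u w ≤ Zsub Γ G u :=
  fun z hz => Subgroup.subset_closure ⟨1, one_mem _, w, hw, z, hz, by simp⟩

theorem ballStab_one_le_centralizer_Zsub (hconn : Γ.Connected)
    (haut : ∀ (g : G) (u w : α), Γ.Adj u w ↔ Γ.Adj (g • u) (g • w)) (u : α) :
    ballStab Γ G u 1 ≤ Subgroup.centralizer (Zsub Γ G u : Set G) := by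
  rw [Subgroup.le_centralizer_iff]
  refine (Subgroup.closure_le _).2 ?_
  rintro k ⟨h, hh, w, hw, z, hz, rfl⟩
  refine Subgroup.mem_centralizer_iff.2 fun q hq => ?_
  have h1 := conj_mem_ballStab_one_of_mem_stabilizer hconn haut hq (inv_mem hh)
  have h2 := (mem_Zuw.1 hz).2.1 _ (ballStab_one_le_stabilizer hconn u h1)
    (((mem_ballStab_one hconn).1 h1).2 w hw)
  calc q * (h * z * h⁻¹) = h * (h⁻¹ * q * h⁻¹⁻¹ * z) * h⁻¹ := by group
    _ = h * (z * (h⁻¹ * q * h⁻¹⁻¹)) * h⁻¹ := by rw [h2]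
    _ = h * z * h⁻¹ * q := by group

theorem eq_one_of_propagates (hconn : Γ.Connected) (hfaith : ∀ g : G, (∀ u : α, g • u = u) → g = 1)
    (P : α → α → Prop) (g : G) (hfix : ∀ u w, P u w → g • u = u)
    (hsymm : ∀ u w, Γ.Adj u w → P u w → P w u)
    (hstep : ∀ u w w', Γ.Adj u w → Γ.Adj u w' → P u w → P u w')
    {x y : α} (hxy : Γ.Adj x y) (h : P x y) : g = 1 := by
  refine hfaith g fun u => ?_
  obtain ⟨w, -, hw⟩ := forall_arc_of_propagates hconn P hsymm hstep hxy h u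
  exact hfix u w hw

theorem eq_one_of_odd_pow_eq_one (hconn : Γ.Connected)
    (hfaith : ∀ g : G, (∀ u : α, g • u = u) → g = 1) (hloc : LocallyL n Γ G)
    {x y : α} (hxy : Γ.Adj x y) {g : G} (hgx : g ∈ stabilizer G x) (hgy : g ∈ stabilizer G y)
    {k : ℕ} (hk : Odd k) (hgk : g ^ k = 1) : g = 1 := by
  refine eq_one_of_propagates hconn hfaith
    (fun u w => g ∈ stabilizer G u ∧ g ∈ stabilizer G w) g (fun u w h => h.1)
    (fun u w _ h => h.symm) (fun u w w' hw hw' h => ⟨h.1, ?_⟩) hxy ⟨hgx, hgy⟩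
  obtain ⟨φ, hφ⟩ := hloc.exists_isLocalChart u
  have h2 := hφ.sq_mem hconn hw h.1 h.2
  obtain ⟨m, rfl⟩ := hk
  have h3 : g⁻¹ = (g ^ 2) ^ m := by
    rw [← pow_mul, inv_eq_iff_mul_eq_one, ← pow_succ', hgk]
  have h4 : g ∈ ballStab Γ G u 1 := by
    rw [← inv_mem_iff, h3]
    exact pow_mem h2 m
  exact ((mem_ballStab_one hconn).1 h4).2 w' hw'

theorem isPGroup_arc_stabilizer (hconn : Γ.Connected)
    (hfaith : ∀ g : G, (∀ u : α, g • u = u) → g = 1) (hloc : LocallyL n Γ G)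
    {x y : α} (hxy : Γ.Adj x y) [Finite (stabilizer G x)] :
    IsPGroup 2 (stabilizer G x ⊓ stabilizer G y : Subgroup G) := by
  intro g
  have hfo : IsOfFinOrder (g : G) :=
    (stabilizer G x).subtype.isOfFinOrder (isOfFinOrder_of_finite (⟨g, g.2.1⟩ : stabilizer G x))
  obtain ⟨k, m, hm, hkm⟩ := Nat.exists_eq_two_pow_mul_odd hfo.orderOf_pos.ne'
  refine ⟨k, Subtype.ext ?_⟩
  refine eq_one_of_odd_pow_eq_one hconn hfaith hloc hxy (pow_mem g.2.1 _) (pow_mem g.2.2 _) hm ?_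
  rw [Subgroup.coe_pow, ← pow_mul, ← hkm, pow_orderOf_eq_one]

theorem exists_mem_Zuw_ne_one (hconn : Γ.Connected)
    (hfaith : ∀ g : G, (∀ u : α, g • u = u) → g = 1) (hloc : LocallyL n Γ G)
    {x y : α} (hxy : Γ.Adj x y) [Finite (stabilizer G x)]
    (hntriv : ballStab Γ G x 1 ⊓ ballStab Γ G y 1 ≠ ⊥) :
    ∃ z ∈ Zuw G x y, z ≠ 1 := by
  have hp := isPGroup_arc_stabilizer (G := G) hconn hfaith hloc hxy
  have hle : stabilizer G x ⊓ stabilizer G y ≤ stabilizer G x := inf_le_left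
  have : Finite (stabilizer G x ⊓ stabilizer G y : Subgroup G) :=
    Finite.of_injective _ (Subgroup.inclusion_injective hle)
  have : Nontrivial (stabilizer G x ⊓ stabilizer G y : Subgroup G) := by
    rw [Subgroup.nontrivial_iff_ne_bot]
    intro h
    refine hntriv (eq_bot_iff.2 (le_trans ?_ h.le))
    exact inf_le_inf (ballStab_one_le_stabilizer hconn x) (ballStab_one_le_stabilizer hconn y)
  have : Fact (Nat.Prime 2) := ⟨Nat.prime_two⟩
  have hc := hp.center_nontrivial
  have hpc := hp.to_subgroup (Subgroup.center _)
  obtain ⟨z, hz⟩ := exists_prime_orderOf_dvd_card' 2 (hpc.card_eq_or_dvd.resolve_left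
    Finite.one_lt_card.ne')
  refine ⟨((z : (stabilizer G x ⊓ stabilizer G y : Subgroup G)) : G), ?_, ?_⟩
  · rw [mem_Zuw]
    refine ⟨z.1.2, fun h hx hy => ?_, ?_⟩
    · exact congrArg Subtype.val (Subgroup.mem_center_iff.1 z.2 ⟨h, hx, hy⟩)
    · have h1 : z ^ 2 = 1 := by rw [← hz, pow_orderOf_eq_one]
      exact congrArg (fun s : Subgroup.center (stabilizer G x ⊓ stabilizer G y : Subgroup G) => (s.1 : G)) h1
  · intro h
    have : z = 1 := Subtype.ext (Subtype.ext h)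
    rw [this, orderOf_one] at hz
    omega

theorem Zuw_le_ballStab_one (hconn : Γ.Connected)
    (haut : ∀ (g : G) (u w : α), Γ.Adj u w ↔ Γ.Adj (g • u) (g • w))
    (hfaith : ∀ g : G, (∀ u : α, g • u = u) → g = 1)
    (harc : ∀ u w u' w' : α, Γ.Adj u w → Γ.Adj u' w' → ∃ g : G, g • u = u' ∧ g • w = w')
    (hloc : LocallyL n Γ G) {x y : α} (hxy : Γ.Adj x y)
    (hntriv : ballStab Γ G x 1 ⊓ ballStab Γ G y 1 ≠ ⊥) {u w : α} (huw : Γ.Adj u w) :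
    Zuw G u w ≤ ballStab Γ G u 1 := by
  intro z₀ hz₀
  by_contra hz₀Q
  have hall : ∀ u' w', Γ.Adj u' w' → ∃ z ∈ Zuw G u' w', z ∉ ballStab Γ G u' 1 := by
    intro u' w' h'
    obtain ⟨g, rfl, rfl⟩ := harc u w u' w' huw h'
    refine ⟨_, conj_mem_Zuw hz₀ g, fun h => hz₀Q ?_⟩
    have h1 := conj_mem_ballStab_one hconn haut h g⁻¹
    rw [inv_smul_smul] at h1
    convert h1 using 1
    group
  refine hntriv (eq_bot_iff.2 fun k hk => ?_)
  refine eq_one_of_propagates hconn hfaith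
    (fun u w => k ∈ ballStab Γ G u 1 ∧ k ∈ ballStab Γ G w 1) k
    (fun u w h => ballStab_one_le_stabilizer hconn u h.1) (fun u w _ h => h.symm)
    (fun u w w' hw hw' h => ⟨h.1, ?_⟩) hxy hk
  obtain ⟨z, hz, hzQ⟩ := hall u w hw
  obtain ⟨φ, hφ⟩ := hloc.exists_isLocalChart u
  have hz' := mem_Zuw.1 hz
  have hnorm := hφ.stabilizer_le hconn hw hz'.1.1 hz'.1.2 hzQ
    (Subgroup.normalizer ((ballStab Γ G u 1 ⊓ ballStab Γ G w 1 : Subgroup G) : Set G)) ?_ ?_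
  · obtain ⟨g, hgu, hgw⟩ := harc u w u w' hw hw'
    have h1 := (Subgroup.mem_normalizer_iff.1 (inv_mem (hnorm hgu)) k).1 h
    have h2 := conj_mem_ballStab_one hconn haut h1.2 g
    rw [hgw] at h2
    convert h2 using 1
    group
  · have hQ : ∀ q ∈ ballStab Γ G u 1, ∀ k ∈ ballStab Γ G u 1 ⊓ ballStab Γ G w 1,
        q * k * q⁻¹ ∈ ballStab Γ G u 1 ⊓ ballStab Γ G w 1 := by
      intro q hq k hk
      exact ⟨Subgroup.mul_mem _ (Subgroup.mul_mem _ hq hk.1) (Subgroup.inv_mem _ hq),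
        conj_mem_ballStab_one_of_mem_stabilizer hconn haut hk.2
          (((mem_ballStab_one hconn).1 hq).2 w hw)⟩
    refine fun q (hq : q ∈ ballStab Γ G u 1) =>
      Subgroup.mem_normalizer_iff.2 fun k => ⟨hQ q hq k, fun hk => ?_⟩
    have := hQ q⁻¹ (inv_mem hq) _ hk
    convert this using 1
    group
  · intro h hh
    refine Subgroup.centralizer_le_normalizer _ ?_
    refine Subgroup.mem_centralizer_iff.2 fun q hq => ?_
    exact Subgroup.mem_centralizer_iff.1
      (Subgroup.le_centralizer_iff.1 (ballStab_one_le_centralizer_Zsub hconn haut u)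
        (conj_mem_Zsub (Zuw_le_Zsub hw hz) hh)) q hq.1

theorem Zsub_le_ballStab_one (hconn : Γ.Connected)
    (haut : ∀ (g : G) (u w : α), Γ.Adj u w ↔ Γ.Adj (g • u) (g • w))
    (hfaith : ∀ g : G, (∀ u : α, g • u = u) → g = 1)
    (harc : ∀ u w u' w' : α, Γ.Adj u w → Γ.Adj u' w' → ∃ g : G, g • u = u' ∧ g • w = w')
    (hloc : LocallyL n Γ G) {x y : α} (hxy : Γ.Adj x y)
    (hntriv : ballStab Γ G x 1 ⊓ ballStab Γ G y 1 ≠ ⊥) (u : α) :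
    Zsub Γ G u ≤ ballStab Γ G u 1 := by
  refine (Subgroup.closure_le _).2 ?_
  rintro k ⟨h, hh, w, hw, z, hz, rfl⟩
  exact conj_mem_ballStab_one_of_mem_stabilizer hconn haut
    (Zuw_le_ballStab_one hconn haut hfaith harc hloc hxy hntriv hw hz) hh

theorem not_stabilizer_le_centralizer_Zsub (hconn : Γ.Connected)
    (hfaith : ∀ g : G, (∀ u : α, g • u = u) → g = 1)
    (harc : ∀ u w u' w' : α, Γ.Adj u w → Γ.Adj u' w' → ∃ g : G, g • u = u' ∧ g • w = w')
    (hloc : LocallyL n Γ G) {x y : α} (hxy : Γ.Adj x y) [Finite (stabilizer G x)]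
    (hntriv : ballStab Γ G x 1 ⊓ ballStab Γ G y 1 ≠ ⊥) {v v' : α} (hv : Γ.Adj v v') :
    ¬ stabilizer G v ≤ Subgroup.centralizer (Zsub Γ G v : Set G) := by
  intro hcent
  have hall : ∀ u w, Γ.Adj u w → ∀ z ∈ Zuw G u w, ∀ h ∈ stabilizer G u, h * z = z * h := by
    intro u w huw z hz h hh
    obtain ⟨g, rfl, rfl⟩ := harc u w v v' huw hv
    have h1 := Zuw_le_Zsub hv (conj_mem_Zuw hz g)
    have h2 := Subgroup.mem_centralizer_iff.1 (hcent (conj_mem_stabilizer hh g)) _ h1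
    have h3 : g * (z * h) * g⁻¹ = g * (h * z) * g⁻¹ := by
      calc g * (z * h) * g⁻¹ = g * z * g⁻¹ * (g * h * g⁻¹) := by group
        _ = g * h * g⁻¹ * (g * z * g⁻¹) := h2
        _ = g * (h * z) * g⁻¹ := by group
    exact (mul_left_cancel (mul_right_cancel h3)).symm
  obtain ⟨z, hz, hz1⟩ := exists_mem_Zuw_ne_one hconn hfaith hloc hxy hntriv
  refine hz1 (eq_one_of_propagates hconn hfaith (fun u w => z ∈ Zuw G u w) z
    (fun u w h => (mem_Zuw.1 h).1.1) (fun u w _ h => Zuw_symm h)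
    (fun u w w' hw hw' h => ?_) hxy hz)
  have h' := mem_Zuw.1 h
  refine mem_Zuw.2 ⟨⟨h'.1.1, ?_⟩, fun k hk _ => hall u w hw z h k hk, h'.2.2⟩
  obtain ⟨g, hgu, rfl⟩ := harc u w u w' hw hw'
  rw [mem_stabilizer_iff, ← mul_smul, ← hall u w hw z h g hgu, mul_smul,
    mem_stabilizer_iff.1 h'.1.2]

theorem Zsub_le_of_dist_lt_critDist {u v : α} (h : Γ.dist u v < critDist Γ G) :
    Zsub Γ G u ≤ ballStab Γ G v 1 := by
  by_contra hnot
  exact Nat.notMem_of_lt_sInf h ⟨u, v, rfl, hnot⟩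

theorem mul_self_of_mem_Zsub {u : α}
    (hcomm : ∀ m ∈ Zsub Γ G u, ∀ m' ∈ Zsub Γ G u, m * m' = m' * m) :
    ∀ m ∈ Zsub Γ G u, m * m = 1 := by
  intro m hm
  induction hm using Subgroup.closure_induction with
  | mem k hk =>
    obtain ⟨h, hh, w, hw, z, hz, rfl⟩ := hk
    rw [← sq, conj_pow, (mem_Zuw.1 hz).2.2]
    simp
  | one => simp
  | mul a b ha hb iha ihb =>
    rw [mul_assoc, ← mul_assoc b, hcomm b hb a ha, mul_assoc, ihb, mul_one, iha]
  | inv a ha iha => rw [← mul_inv_rev, iha, inv_one]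

theorem conj_eq_of_inv_mul_mem (hconn : Γ.Connected)
    (haut : ∀ (g : G) (u w : α), Γ.Adj u w ↔ Γ.Adj (g • u) (g • w)) {u : α} {g g' m : G}
    (h : g'⁻¹ * g ∈ ballStab Γ G u 1) (hm : m ∈ Zsub Γ G u) :
    MulAut.conj g m = MulAut.conj g' m := by
  have h1 := Subgroup.mem_centralizer_iff.1 (ballStab_one_le_centralizer_Zsub hconn haut u h) m hm
  simp only [MulAut.conj_apply]
  calc g * m * g⁻¹ = g' * (g'⁻¹ * g * m) * g⁻¹ := by group
    _ = g' * (m * (g'⁻¹ * g)) * g⁻¹ := by rw [h1]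
    _ = g' * m * g'⁻¹ := by group

end ArcCentre

/-- if `T` is a Sylow 3-subgroup of `G_x`, `T₀ ≤ T` and
`C_{Z_x}(T) < C_{Z_x}(T₀)`, then `[T₀, Z_x] = 1`. -/
theorem subgroup_of_sylow_centralizes_Zx
    {α : Type*} (n : ℕ) (hn : 2 ≤ n) (Γ : SimpleGraph α)
    (G : Type*) [Group G] [MulAction G α]
    (hconn : Γ.Connected) (hacyc : Γ.IsAcyclic)
    (haut : ∀ (g : G) (u w : α), Γ.Adj u w ↔ Γ.Adj (g • u) (g • w))
    (hfaith : ∀ g : G, (∀ u : α, g • u = u) → g = 1)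
    (harc : ∀ u w u' w' : α, Γ.Adj u w → Γ.Adj u' w' → ∃ g : G, g • u = u' ∧ g • w = w')
    (hfin : ∀ u : α, Finite (stabilizer G u))
    (hloc : LocallyL n Γ G)
    (x y : α) (hxy : Γ.Adj x y)
    (hntriv : ballStab Γ G x 1 ⊓ ballStab Γ G y 1 ≠ ⊥)
    (v : α) (hcrit : critPair Γ G x v)
    (b : ℕ) (hb : b = critDist Γ G)
    (p : ℕ → α) (hp0 : p 0 = x) (hpb : p b = v)
    (hpadj : ∀ i, i < b → Γ.Adj (p i) (p (i + 1)))
    (hy : y = p 1)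
    (T : Sylow 3 ↥(stabilizer G x))
    (T₀ : Subgroup ↥(stabilizer G x)) (hT₀ : T₀ ≤ T)
    (hlt : Zsub Γ G x ⊓ Subgroup.centralizer
        (((T : Subgroup ↥(stabilizer G x)).map (stabilizer G x).subtype : Subgroup G) :
          Set G) <
      Zsub Γ G x ⊓ Subgroup.centralizer
        ((T₀.map (stabilizer G x).subtype : Subgroup G) : Set G)) :
    ∀ t ∈ T₀.map (stabilizer G x).subtype, ∀ z ∈ Zsub Γ G x, t * z = z * t := by
  have hZQ := Zsub_le_ballStab_one (G := G) hconn haut hfaith harc hloc hxy hntriv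
  have hQC := ballStab_one_le_centralizer_Zsub (Γ := Γ) (G := G) hconn haut
  have : Finite (stabilizer G x) := hfin x
  subst hb hy
  obtain ⟨hdist, hnot⟩ := hcrit
  set b := critDist Γ G with hbdef
  have hbpos : 0 < b := by
    rcases Nat.eq_zero_or_pos b with h | h
    · rw [h, hconn.dist_eq_zero_iff] at hdist
      exact absurd (hdist ▸ hZQ x) hnot
    · exact h
  have hpath : ∀ i j, i + j ≤ b → Γ.dist (p i) (p (i + j)) ≤ j := by
    intro i j
    induction j with
    | zero => intro _; simp
    | succ j ih =>
      intro hij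
      have h1 := ih (by omega)
      have h2 := SimpleGraph.dist_eq_one_iff_adj.2 (hpadj (i + j) (by omega))
      have h3 := hconn.dist_triangle (u := p i) (v := p (i + j)) (w := p (i + j + 1))
      rw [← add_assoc]
      omega
  have hvadj : Γ.Adj v (p (b - 1)) := by
    have := hpadj (b - 1) (by omega)
    rw [Nat.sub_add_cancel hbpos, hpb] at this
    exact this.symm
  have hxv' : Zsub Γ G x ≤ ballStab Γ G (p (b - 1)) 1 := by
    refine Zsub_le_of_dist_lt_critDist ?_
    have := hpath 0 (b - 1) (by omega)
    rw [hp0, zero_add] at this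
    omega
  have hvy : Zsub Γ G v ≤ ballStab Γ G (p 1) 1 := by
    refine Zsub_le_of_dist_lt_critDist ?_
    have := hpath 1 (b - 1) (by omega)
    rw [Nat.add_sub_cancel' hbpos, hpb] at this
    rw [SimpleGraph.dist_comm]
    omega
  have hxstab : ∀ m ∈ Zsub Γ G x, m ∈ stabilizer G v ∧ m ∈ stabilizer G (p (b - 1)) :=
    fun m hm => ⟨((mem_ballStab_one hconn).1 (hxv' hm)).2 v hvadj.symm,
      ((mem_ballStab_one hconn).1 (hxv' hm)).1⟩
  have hvstab : ∀ m ∈ Zsub Γ G v, m ∈ stabilizer G x ∧ m ∈ stabilizer G (p 1) :=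
    fun m hm => ⟨((mem_ballStab_one hconn).1 (hvy hm)).2 x hxy.symm,
      ((mem_ballStab_one hconn).1 (hvy hm)).1⟩
  obtain ⟨m₀, hm₀, hm₀Q⟩ := SetLike.not_le_iff_exists.1 hnot
  obtain ⟨ψ, hψ⟩ := hloc.exists_isLocalChart v
  obtain ⟨φ, hφ⟩ := hloc.exists_isLocalChart x
  have hnot' : ¬ Zsub Γ G v ≤ ballStab Γ G x 1 := by
    intro hle
    refine not_stabilizer_le_centralizer_Zsub hconn hfaith harc hloc hxy hntriv hvadj
      (hψ.stabilizer_le hconn hvadj (hxstab m₀ hm₀).1 (hxstab m₀ hm₀).2 hm₀Q _ (hQC v) ?_)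
    intro k hk
    refine Subgroup.mem_centralizer_iff.2 fun z hz => ?_
    have h1 := conj_mem_Zsub hz (inv_mem hk)
    have h2 := Subgroup.mem_centralizer_iff.1 (hQC x (hle h1)) m₀ hm₀
    calc z * (k * m₀ * k⁻¹) = k * (k⁻¹ * z * k⁻¹⁻¹ * m₀) * k⁻¹ := by group
      _ = k * (m₀ * (k⁻¹ * z * k⁻¹⁻¹)) * k⁻¹ := by rw [h2]
      _ = k * m₀ * k⁻¹ * z := by group
  obtain ⟨t, ht, htQ⟩ := SetLike.not_le_iff_exists.1 hnot'
  have htx := (hvstab t ht).1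
  have htneg := hφ.neg_of_notMem hconn hxy htx (hvstab t ht).2 htQ
  have hcomm : ∀ m ∈ Zsub Γ G x, ∀ m' ∈ Zsub Γ G x, m * m' = m' * m :=
    fun m hm m' hm' => (Subgroup.mem_centralizer_iff.1 (hQC x (hZQ x hm)) m' hm').symm
  have hT : ∀ a ∈ (T : Subgroup ↥(stabilizer G x)).map (stabilizer G x).subtype,
      a ∈ stabilizer G x ∧ ∃ w, ActsAffinely φ a 1 w := by
    rintro _ ⟨a, ha, rfl⟩
    refine ⟨a.2, ?_⟩
    obtain ⟨k, hk⟩ := T.isPGroup' ⟨a, ha⟩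
    refine hφ.translation_of_pow_eq_one (by omega) a.2 (k := 3 ^ k) (Odd.pow (by decide)) ?_
    exact congrArg (fun s : T => ((s : stabilizer G x) : G)) hk
  have hcube : ∀ a ∈ stabilizer G x, (∃ w, ActsAffinely φ a 1 w) → ∀ m ∈ Zsub Γ G x,
      MulAut.conj a (MulAut.conj a (MulAut.conj a m)) = m := by
    rintro a ha ⟨w, hw⟩ m hm
    have h1 : (1 : G)⁻¹ * (a * a * a) ∈ ballStab Γ G x 1 := by
      refine ActsAffinely.inv_mul_mem_ballStab_one (φ := φ) (e := 1) (w := 0) hconn (one_mem _)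
        (mul_mem (mul_mem ha ha) ha) (by decide) ActsAffinely.one ?_
      convert (hw.mul hw).mul hw using 1
      · decide
      ext i
      simp only [Pi.add_apply, Pi.smul_apply, Pi.zero_apply, smul_eq_mul]
      generalize w i = s
      revert s
      decide
    simpa only [map_mul, MulAut.mul_apply, map_one, MulAut.one_apply] using
      conj_eq_of_inv_mul_mem hconn haut h1 hm
  have hinvert : ∀ a ∈ stabilizer G x, (∃ w, ActsAffinely φ a 1 w) → ∀ m ∈ Zsub Γ G x,
      MulAut.conj t (MulAut.conj a m) = MulAut.conj a (MulAut.conj a (MulAut.conj t m)) := by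
    rintro a ha ⟨w, hw⟩ m hm
    have h1 : (a * a * t)⁻¹ * (t * a) ∈ ballStab Γ G x 1 := by
      refine ActsAffinely.inv_mul_mem_ballStab_one hconn (mul_mem (mul_mem ha ha) htx)
        (mul_mem htx ha) (by decide) ((hw.mul hw).mul htneg) ?_
      convert htneg.mul hw using 1
      · decide
      ext i
      simp only [Pi.add_apply, Pi.smul_apply, smul_eq_mul]
      generalize w i = s
      generalize φ ⟨p 1, hxy⟩ i = r
      revert s r
      decide
    simpa only [map_mul, MulAut.mul_apply] using conj_eq_of_inv_mul_mem hconn haut h1 hm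
  have hT₀T : T₀.map (stabilizer G x).subtype ≤
      (T : Subgroup ↥(stabilizer G x)).map (stabilizer G x).subtype := Subgroup.map_mono hT₀
  by_contra! hcon
  obtain ⟨a, ha, z, hz, haz⟩ := hcon
  obtain ⟨hax, haw⟩ := hT a (hT₀T ha)
  refine hlt.2 ?_
  rintro m ⟨hm, hmC⟩
  refine ⟨hm, Subgroup.mem_centralizer_iff.2 fun a' ha' => ?_⟩
  obtain ⟨hax', haw'⟩ := hT a' ha'
  have hm₁ : MulAut.conj t m₀ ∈ Zsub Γ G x := conj_mem_Zsub hm₀ htx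
  have hmain := fixed_of_fixed_of_transvection (Zsub Γ G x) (mul_self_of_mem_Zsub hcomm)
    (MulAut.conj a).toMonoidHom (MulAut.conj a').toMonoidHom (MulAut.conj t).toMonoidHom
    (fun m hm => conj_mem_Zsub hm hax) (fun m hm => conj_mem_Zsub hm hax')
    (hcube a hax haw) (hcube a' hax' haw') ?_ (hinvert a hax haw) (hinvert a' hax' haw')
    (m₀⁻¹ * MulAut.conj t m₀) (mul_mem (inv_mem hm₀) hm₁) ?_ ⟨z, hz, ?_⟩ m hm ?_
  · exact mul_inv_eq_iff_eq_mul.1 hmain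
  · intro m hm
    obtain ⟨w, hw⟩ := haw
    obtain ⟨w', hw'⟩ := haw'
    have h1 : (a' * a)⁻¹ * (a * a') ∈ ballStab Γ G x 1 := by
      refine ActsAffinely.inv_mul_mem_ballStab_one hconn (mul_mem hax' hax) (mul_mem hax hax')
        (by decide) (hw'.mul hw) ?_
      convert hw.mul hw' using 1
      rw [one_smul, one_smul, add_comm]
    have h2 := conj_eq_of_inv_mul_mem hconn haut h1 hm
    rwa [map_mul, map_mul] at h2
  · have hfix : ∀ q ∈ ballStab Γ G v 1, MulAut.conj t q = q := fun q hq =>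
      mul_inv_eq_iff_eq_mul.2 (Subgroup.mem_centralizer_iff.1 (hQC v hq) t ht)
    intro m hm
    by_cases hmQ : m ∈ ballStab Γ G v 1
    · exact Or.inl (hfix m hmQ)
    · right
      have hq := hψ.inv_mul_mem hconn hvadj (hxstab m₀ hm₀).1 (hxstab m₀ hm₀).2 hm₀Q
        (hxstab m hm).1 (hxstab m hm).2 hmQ
      have h1 := hfix _ hq
      rw [map_mul, map_inv, inv_mul_eq_iff_eq_mul] at h1
      change MulAut.conj t m = _
      rw [h1, hcomm _ hm₁ _ (mul_mem (inv_mem hm₀) hm), hcomm _ (inv_mem hm₀) m hm, mul_assoc]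
  · exact fun h => haz (mul_inv_eq_iff_eq_mul.1 h)
  · exact mul_inv_eq_iff_eq_mul.2 (Subgroup.mem_centralizer_iff.1 hmC a ha)
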